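/- Squared-localization identity with second-commutator remainder (bounded version): Let 𝓗 be a complex Hilbert space, B and D bounded self-adjoint operators on 𝓗, f : ℝ → ℝ a compactly supported smooth function, and f̃ an almost analytic extension of f. Then (1/2)( f(B)² D + D f(B)² ) = f(B) D f(B) + R₂, where R₂ = (2π²)^{-1} ∫_ℂ ∫_ℂ (∂̄f̃)(z₂)(∂̄f̃)(z₁) (B - z₂)^{-1}(B - z₁)^{-1} [[D, B], B] (B - z₁)^{-1}(B - z₂)^{-1} du₁ dv₁ du₂ dv₂ and [S, T] = ST - TS. -/

import Mathlib

open MeasureTheory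

/-- The Cauchy–Riemann operator `∂̄ = (1/2)(∂_u + i ∂_v)` acting on functions of
`z = u + iv ∈ ℂ`, viewed as smooth functions of the two real variables `u, v`. -/
noncomputable def dbar (f : ℂ → ℂ) (z : ℂ) : ℂ :=
  (1 / 2) * (fderiv ℝ f z 1 + Complex.I * fderiv ℝ f z Complex.I)


lemma dbar_eq_polar (L : ℂ →L[ℝ] ℂ) (θ : ℝ) :
    L (Complex.exp (θ * Complex.I)) + Complex.I * L (Complex.I * Complex.exp (θ * Complex.I)) =
      (Complex.exp (θ * Complex.I))⁻¹ * (L 1 + Complex.I * L Complex.I) := by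
  have h1 : Complex.exp (θ * Complex.I) = (Real.cos θ) • (1 : ℂ) + (Real.sin θ) • Complex.I := by
    rw [Complex.exp_mul_I]; simp
  have h2 : Complex.I * Complex.exp (θ * Complex.I) =
      (-Real.sin θ) • (1 : ℂ) + (Real.cos θ) • Complex.I := by
    rw [Complex.exp_mul_I]; simp
    linear_combination (Complex.sin θ) * Complex.I_sq
  have h3 : (Complex.exp (θ * Complex.I))⁻¹ = Real.cos θ - Real.sin θ * Complex.I := by
    rw [← Complex.exp_neg, ← neg_mul, Complex.exp_mul_I]; simp; ring
  rw [h3, h2, h1]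
  rw [map_add, map_add, map_smul, map_smul, map_smul, map_smul]
  simp only [Complex.real_smul]
  push_cast
  linear_combination Complex.sin θ * L Complex.I * (Complex.I_sq)

lemma cauchy_pompeiu (F : ℂ → ℂ) (hF : ContDiff ℝ (⊤ : ℕ∞) F) (hs : HasCompactSupport F) (w : ℂ) :
    ∫ z : ℂ, dbar F z * (w - z)⁻¹ = Real.pi * F w := by
  have hd : Differentiable ℝ F := hF.differentiable (by simp)
  have hdc : Continuous (fderiv ℝ F) := hF.continuous_fderiv (by simp)
  obtain ⟨R, hR0, hR⟩ : ∃ R : ℝ, 0 < R ∧ ∀ z : ℂ, R < ‖z - w‖ → z ∉ tsupport F := by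
    obtain ⟨R, hR⟩ := hs.isCompact.isBounded.subset_closedBall w
    refine ⟨max R 1, by positivity, fun z hz hz' => ?_⟩
    have := hR hz'
    rw [Metric.mem_closedBall, dist_eq_norm] at this
    exact absurd (this.trans (le_max_left R 1)) (not_le.mpr hz)
  set P : ℝ → ℝ → ℂ := fun r θ => w + r * Complex.exp (θ * Complex.I) with hP
  have hPn : ∀ r θ : ℝ, ‖P r θ - w‖ = |r| := by
    intro r θ; simp [hP, Complex.norm_exp_ofReal_mul_I]
  set A : ℝ × ℝ → ℂ := fun p => fderiv ℝ F (P p.1 p.2) (Complex.exp (p.2 * Complex.I)) with hA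
  set B : ℝ × ℝ → ℂ :=
    fun p => fderiv ℝ F (P p.1 p.2) (Complex.I * Complex.exp (p.2 * Complex.I)) with hB
  have hPc : Continuous (fun p : ℝ × ℝ => P p.1 p.2) := by fun_prop
  have hAc : Continuous A := by
    have := hdc.comp hPc
    exact this.clm_apply (by fun_prop)
  have hBc : Continuous B := by
    have := hdc.comp hPc
    exact this.clm_apply (by fun_prop)
  have hz : ∀ r θ : ℝ, R < r → fderiv ℝ F (P r θ) = 0 := by
    intro r θ hr
    apply fderiv_of_notMem_tsupport
    apply hR
    rw [hPn]; exact hr.trans_le (le_abs_self r)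
  have hFz : ∀ r θ : ℝ, R < r → F (P r θ) = 0 := by
    intro r θ hr
    apply image_eq_zero_of_notMem_tsupport
    apply hR
    rw [hPn]; exact hr.trans_le (le_abs_self r)
  have hint : ∀ G : ℝ × ℝ → ℂ, Continuous G → (∀ p : ℝ × ℝ, R < p.1 → G p = 0) →
      IntegrableOn G (Set.Ioi (0 : ℝ) ×ˢ Set.Ioo (-Real.pi) Real.pi) := by
    intro G hG hG0
    have h1 : IntegrableOn G (Set.Icc (0 : ℝ) R ×ˢ Set.Icc (-Real.pi) Real.pi) :=
      hG.continuousOn.integrableOn_compact (isCompact_Icc.prod isCompact_Icc)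
    refine IntegrableOn.of_forall_sdiff_eq_zero h1
      (measurableSet_Ioi.prod measurableSet_Ioo) ?_
    rintro ⟨r, θ⟩ ⟨⟨h1, h2⟩, h3⟩
    apply hG0
    by_contra hcon
    exact h3 ⟨⟨le_of_lt h1, not_lt.mp hcon⟩, ⟨h2.1.le, h2.2.le⟩⟩
  have hAi := hint A hAc (fun p hp => by simp [hA, hz _ _ hp])
  have hBi := hint B hBc (fun p hp => by simp [hB, hz _ _ hp])
  have step1 : ∫ z : ℂ, dbar F z * (w - z)⁻¹ = ∫ z : ℂ, dbar F (w + z) * (w - (w + z))⁻¹ :=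
    (integral_add_left_eq_self (fun z => dbar F z * (w - z)⁻¹) w).symm
  have step2 : ∫ z : ℂ, dbar F (w + z) * (w - (w + z))⁻¹ =
      ∫ p in Set.Ioi (0 : ℝ) ×ˢ Set.Ioo (-Real.pi) Real.pi,
        (-(1 / 2 : ℂ)) * (A p + Complex.I * B p) := by
    rw [← Complex.integral_comp_polarCoord_symm]
    refine setIntegral_congr_fun (measurableSet_Ioi.prod measurableSet_Ioo) ?_
    rintro ⟨r, θ⟩ ⟨hr, hθ⟩
    have hr' : (r : ℂ) ≠ 0 := by
      have : (0 : ℝ) < r := hr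
      exact_mod_cast this.ne'
    have he : Complex.polarCoord.symm (r, θ) = r * Complex.exp (θ * Complex.I) := by
      rw [Complex.polarCoord_symm_apply, Complex.exp_mul_I]; simp
    have := dbar_eq_polar (fderiv ℝ F (P r θ)) θ
    simp only [he, hA, hB]
    rw [this]
    simp only [dbar, hP, Complex.real_smul]
    have := Complex.exp_ne_zero (θ * Complex.I)
    field_simp
    ring
  have hAint : ∫ p in Set.Ioi (0 : ℝ) ×ˢ Set.Ioo (-Real.pi) Real.pi, A p
      = -(2 * Real.pi) * F w := by
    rw [Measure.volume_eq_prod] at hAi ⊢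
    rw [← setIntegral_prod_swap, setIntegral_prod (fun z : ℝ × ℝ => A z.swap) hAi.swap]
    have : ∀ θ : ℝ, ∫ r in Set.Ioi (0 : ℝ), A (r, θ) = - F w := by
      intro θ
      have hder : ∀ r : ℝ, HasDerivAt (fun r : ℝ => F (P r θ)) (A (r, θ)) r := by
        intro r
        have h1 : HasDerivAt (fun r : ℝ => P r θ) (Complex.exp (θ * Complex.I)) r := by
          have := ((Complex.ofRealCLM.hasDerivAt (x := r)).mul_const
            (Complex.exp (θ * Complex.I))).const_add w
          simpa [hP] using this
        exact (hd (P r θ)).hasFDerivAt.comp_hasDerivAt r h1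
      have := integral_Ioi_of_hasDerivAt_of_tendsto' (a := (0 : ℝ)) (m := (0 : ℂ))
        (f := fun r : ℝ => F (P r θ)) (f' := fun r => A (r, θ)) (fun r _ => hder r) ?_ ?_
      · rw [this]; simp [hP]
      · have h1 : IntegrableOn (fun r => A (r, θ)) (Set.Icc (0 : ℝ) R) :=
          (hAc.comp (by fun_prop)).continuousOn.integrableOn_compact isCompact_Icc
        refine IntegrableOn.of_forall_sdiff_eq_zero h1 measurableSet_Ioi ?_
        rintro r ⟨h1, h3⟩
        have : R < r := by
          by_contra hcon
          exact h3 ⟨le_of_lt h1, not_lt.mp hcon⟩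
        simp [hA, hz _ _ this]
      · refine tendsto_const_nhds.congr' ?_
        filter_upwards [Filter.eventually_gt_atTop R] with r hr
        exact (hFz r θ hr).symm
    simp only [Prod.swap_prod_mk, this]
    rw [setIntegral_const, Real.volume_real_Ioo_of_le (by linarith [Real.pi_pos]),
      Complex.real_smul]
    push_cast
    ring
  have hBint : ∫ p in Set.Ioi (0 : ℝ) ×ˢ Set.Ioo (-Real.pi) Real.pi, B p = 0 := by
    rw [Measure.volume_eq_prod] at hBi ⊢
    rw [setIntegral_prod _ hBi]
    have : ∀ r ∈ Set.Ioi (0 : ℝ), ∫ θ in Set.Ioo (-Real.pi) Real.pi, B (r, θ) = 0 := by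
      intro r hr
      have hr' : (r : ℂ) ≠ 0 := by
        have : (0 : ℝ) < r := hr
        exact_mod_cast this.ne'
      have hder : ∀ θ : ℝ, HasDerivAt (fun θ : ℝ => F (P r θ)) ((r : ℝ) • B (r, θ)) θ := by
        intro θ
        have h1 : HasDerivAt (fun θ : ℝ => P r θ)
            (r • (Complex.I * Complex.exp (θ * Complex.I))) θ := by
          have := ((((Complex.ofRealCLM.hasDerivAt (x := θ)).mul_const
            Complex.I).cexp).const_mul (r : ℂ)).const_add w
          simp only [Complex.ofRealCLM_apply, Complex.ofReal_one, one_mul] at this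
          have e : (r • (Complex.I * Complex.exp (θ * Complex.I)) : ℂ) =
              r * (Complex.exp (θ * Complex.I) * Complex.I) := by
            rw [Complex.real_smul]; ring
          rw [e]; exact this
        have h2 := (hd (P r θ)).hasFDerivAt.comp_hasDerivAt θ h1
        rw [map_smul] at h2
        exact h2
      have hBcr : Continuous (fun θ => (r : ℝ) • B (r, θ)) :=
        (hBc.comp (by fun_prop : Continuous fun θ : ℝ => (r, θ))).const_smul r
      have := intervalIntegral.integral_eq_sub_of_hasDerivAt (a := -Real.pi) (b := Real.pi)
        (fun θ _ => hder θ) (hBcr.intervalIntegrable _ _)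
      have hper : P r Real.pi = P r (-Real.pi) := by
        simp [hP, Complex.exp_neg]
      rw [hper, sub_self, intervalIntegral.integral_smul,
        intervalIntegral.integral_of_le (by linarith [Real.pi_pos]),
        integral_Ioc_eq_integral_Ioo, Complex.real_smul] at this
      exact (mul_eq_zero.mp this).resolve_left hr'
    rw [setIntegral_congr_fun measurableSet_Ioi this]
    simp
  rw [step1, step2, integral_const_mul, integral_add hAi (hBi.const_mul _), integral_const_mul,
    hAint, hBint]
  ring

lemma dbar_continuous (F : ℂ → ℂ) (hF : ContDiff ℝ (⊤ : ℕ∞) F) : Continuous (dbar F) := by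
  have hdc : Continuous (fderiv ℝ F) := hF.continuous_fderiv (by simp)
  unfold dbar
  fun_prop

lemma helffer_sjostrand
    {𝓗 : Type*} [NormedAddCommGroup 𝓗] [InnerProductSpace ℂ 𝓗] [CompleteSpace 𝓗]
    (B : 𝓗 →L[ℂ] 𝓗) (hB : IsSelfAdjoint B) (f : ℝ → ℝ)
    (ftil : ℂ → ℂ) (hft : ContDiff ℝ (⊤ : ℕ∞) ftil) (hftsupp : HasCompactSupport ftil)
    (hext : ∀ x : ℝ, ftil (x : ℂ) = (f x : ℂ))
    (haa : ∀ k : ℕ, ∃ C : ℝ, ∀ z : ℂ, ‖dbar ftil z‖ ≤ C * |z.im| ^ k) :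
    Integrable (fun z : ℂ => dbar ftil z • Ring.inverse (B - z • (1 : 𝓗 →L[ℂ] 𝓗))) ∧
    ∫ z : ℂ, dbar ftil z • Ring.inverse (B - z • (1 : 𝓗 →L[ℂ] 𝓗)) =
      (Real.pi : ℂ) • cfc (fun z : ℂ => (f z.re : ℂ)) B := by
  have hn : IsStarNormal B := hB.isStarNormal
  have him : ∀ w ∈ spectrum ℂ B, w.im = 0 := fun w hw => hB.im_eq_zero_of_mem_spectrum hw
  have hz0 : ∀ z : ℂ, z.im = 0 → dbar ftil z = 0 := by
    intro z hz
    obtain ⟨C, hC⟩ := haa 1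
    have := hC z
    simpa [hz] using this
  have hne : ∀ z : ℂ, z.im ≠ 0 → ∀ w ∈ spectrum ℂ B, w - z ≠ 0 := by
    intro z hz w hw h
    have := congrArg Complex.im h
    simp [him w hw] at this
    exact hz this
  have hle : ∀ z : ℂ, z.im ≠ 0 → ∀ w ∈ spectrum ℂ B, ‖(w - z)⁻¹‖ ≤ |z.im|⁻¹ := by
    intro z hz w hw
    rw [norm_inv]
    have h1 := Complex.abs_im_le_norm (w - z)
    rw [Complex.sub_im, him w hw, zero_sub, abs_neg] at h1
    exact inv_anti₀ (abs_pos.mpr hz) h1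
  set G : ℂ → ℂ → ℂ := fun z w => dbar ftil z * (w - z)⁻¹ with hG
  have hbd : ∀ (k : ℕ) (C : ℝ), (∀ z : ℂ, ‖dbar ftil z‖ ≤ C * |z.im| ^ (k + 1)) →
      ∀ z : ℂ, ∀ w ∈ spectrum ℂ B, z.im ≠ 0 → ‖G z w‖ ≤ C * |z.im| ^ k := by
    intro k C hC z w hw hz
    have hp := abs_pos.mpr hz
    rw [hG]
    simp only [norm_mul]
    calc ‖dbar ftil z‖ * ‖(w - z)⁻¹‖ ≤ (C * |z.im| ^ (k + 1)) * |z.im|⁻¹ :=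
          mul_le_mul (hC z) (hle z hz w hw) (norm_nonneg _) ((norm_nonneg _).trans (hC z))
      _ = C * |z.im| ^ k := by rw [pow_succ]; field_simp
  have hcont : ContinuousOn (Function.uncurry G) (Set.univ ×ˢ spectrum ℂ B) := by
    rintro ⟨z, w⟩ ⟨-, hw⟩
    by_cases hz : z.im = 0
    · obtain ⟨C, hC⟩ := haa 2
      have hv : Function.uncurry G (z, w) = 0 := by simp [hG, hz0 z hz]
      rw [ContinuousWithinAt, hv]
      have hlim : Filter.Tendsto (fun p : ℂ × ℂ => C * |p.1.im| ^ 1)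
          (nhdsWithin (z, w) (Set.univ ×ˢ spectrum ℂ B)) (nhds 0) := by
        have : Continuous (fun p : ℂ × ℂ => C * |p.1.im| ^ 1) := by fun_prop
        have h2 := (this.tendsto (z, w)).mono_left
          (nhdsWithin_le_nhds (s := Set.univ ×ˢ spectrum ℂ B))
        simpa [hz] using h2
      refine squeeze_zero_norm' ?_ hlim
      filter_upwards [self_mem_nhdsWithin] with p hp
      by_cases hpz : p.1.im = 0
      · simp [Function.uncurry, hG, hz0 _ hpz, hpz]
      · exact hbd 1 C hC p.1 p.2 hp.2 hpz
    · apply ContinuousAt.continuousWithinAt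
      have hdc := dbar_continuous ftil hft
      have h1 : ContinuousAt (fun p : ℂ × ℂ => dbar ftil p.1) (z, w) := by fun_prop
      have h2 : ContinuousAt (fun p : ℂ × ℂ => (p.2 - p.1)⁻¹) (z, w) :=
        ContinuousAt.inv₀ (by fun_prop) (hne z hz w hw)
      exact h1.mul h2
  obtain ⟨C, hC⟩ := haa 1
  have hbound : ∀ z : ℂ, ∀ w ∈ spectrum ℂ B,
      ‖G z w‖ ≤ (tsupport ftil).indicator (fun _ => |C|) z := by
    intro z w hw
    by_cases hzs : z ∈ tsupport ftil
    · rw [Set.indicator_of_mem hzs]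
      by_cases hz : z.im = 0
      · simp [hG, hz0 z hz]
      · have := hbd 0 C hC z w hw hz
        rw [pow_zero, mul_one] at this
        exact this.trans (le_abs_self C)
    · rw [Set.indicator_of_notMem hzs]
      simp [hG, dbar, fderiv_of_notMem_tsupport ℝ hzs]
  have hboundi : Integrable ((tsupport ftil).indicator (fun _ => |C|)) (volume : Measure ℂ) := by
    rw [integrable_indicator_iff (isClosed_tsupport ftil).measurableSet]
    exact integrableOn_const hftsupp.isCompact.measure_lt_top.ne
  have hcfc : ∀ z : ℂ, cfc (G z) B =
      dbar ftil z • Ring.inverse (B - z • (1 : 𝓗 →L[ℂ] 𝓗)) := by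
    intro z
    by_cases hz : z.im = 0
    · simp [hG, hz0 z hz]
    · have hc : ContinuousOn (fun w : ℂ => (w - z)⁻¹) (spectrum ℂ B) :=
        ContinuousOn.inv₀ (by fun_prop) (hne z hz)
      rw [hG, cfc_const_mul _ _ _ hc, cfc_inv (fun w : ℂ => w - z) B (hne z hz) (by fun_prop),
        cfc_sub (fun w : ℂ => w) (fun _ => z) B, cfc_id' ℂ B, cfc_const z B, Algebra.algebraMap_eq_smul_one]
  have hI := integrable_cfc (μ := (volume : Measure ℂ)) G _ B hcont
    (.of_forall hbound) hboundi.hasFiniteIntegral hn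
  have hE := cfc_integral (μ := (volume : Measure ℂ)) G _ B hcont
    (.of_forall hbound) hboundi.hasFiniteIntegral hn
  simp only [hcfc] at hI hE
  refine ⟨hI, ?_⟩
  rw [← hE]
  have hcp : ∀ w, ∫ z : ℂ, G z w = Real.pi * ftil w := cauchy_pompeiu ftil hft hftsupp
  simp only [hcp]
  have hcf := hft.continuous
  rw [cfc_const_mul _ _ _ hcf.continuousOn]
  congr 1
  apply cfc_congr
  intro w hw
  have := hB.mem_spectrum_eq_re hw
  show ftil w = _
  conv_lhs => rw [this]
  exact hext _

lemma commutator_integral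
    {𝓗 : Type*} [NormedAddCommGroup 𝓗] [InnerProductSpace ℂ 𝓗] [CompleteSpace 𝓗]
    (B : 𝓗 →L[ℂ] 𝓗) (hB : IsSelfAdjoint B) (f : ℝ → ℝ)
    (ftil : ℂ → ℂ) (hft : ContDiff ℝ (⊤ : ℕ∞) ftil) (hftsupp : HasCompactSupport ftil)
    (hext : ∀ x : ℝ, ftil (x : ℂ) = (f x : ℂ))
    (haa : ∀ k : ℕ, ∃ C : ℝ, ∀ z : ℂ, ‖dbar ftil z‖ ≤ C * |z.im| ^ k) (K : 𝓗 →L[ℂ] 𝓗) :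
    Integrable (fun z : ℂ => dbar ftil z • (Ring.inverse (B - z • (1 : 𝓗 →L[ℂ] 𝓗)) *
      (K * B - B * K) * Ring.inverse (B - z • (1 : 𝓗 →L[ℂ] 𝓗)))) ∧
    ∫ z : ℂ, dbar ftil z • (Ring.inverse (B - z • (1 : 𝓗 →L[ℂ] 𝓗)) *
      (K * B - B * K) * Ring.inverse (B - z • (1 : 𝓗 →L[ℂ] 𝓗))) =
      (Real.pi : ℂ) • (cfc (fun z : ℂ => (f z.re : ℂ)) B * K -
        K * cfc (fun z : ℂ => (f z.re : ℂ)) B) := by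
  obtain ⟨hI, hE⟩ := helffer_sjostrand B hB f ftil hft hftsupp hext haa
  have hkey : ∀ z : ℂ, dbar ftil z • (Ring.inverse (B - z • (1 : 𝓗 →L[ℂ] 𝓗)) *
      (K * B - B * K) * Ring.inverse (B - z • (1 : 𝓗 →L[ℂ] 𝓗))) =
      (dbar ftil z • Ring.inverse (B - z • (1 : 𝓗 →L[ℂ] 𝓗))) * K -
        K * (dbar ftil z • Ring.inverse (B - z • (1 : 𝓗 →L[ℂ] 𝓗))) := by
    intro z
    by_cases hz : z.im = 0
    · have : dbar ftil z = 0 := by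
        obtain ⟨C, hC⟩ := haa 1
        have := hC z
        simpa [hz] using this
      simp [this]
    · have hu : IsUnit (B - z • (1 : 𝓗 →L[ℂ] 𝓗)) := by
        have h1 : z ∉ spectrum ℂ B := fun h => hz (hB.im_eq_zero_of_mem_spectrum h)
        rw [spectrum.notMem_iff, Algebra.algebraMap_eq_smul_one] at h1
        simpa using h1.neg
      have e1 := Ring.inverse_mul_cancel _ hu
      have e2 := Ring.mul_inverse_cancel _ hu
      set R := Ring.inverse (B - z • (1 : 𝓗 →L[ℂ] 𝓗)) with hR
      have e3 : K * B - B * K =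
          K * (B - z • (1 : 𝓗 →L[ℂ] 𝓗)) - (B - z • (1 : 𝓗 →L[ℂ] 𝓗)) * K := by
        simp only [mul_sub, sub_mul, mul_smul_comm, smul_mul_assoc, one_mul, mul_one]
        abel
      rw [smul_mul_assoc, mul_smul_comm, ← smul_sub, e3, mul_sub, sub_mul]
      congr 1
      rw [← mul_assoc, mul_assoc (R * K), e2, mul_one, ← mul_assoc R, e1, one_mul]
  simp only [hkey]
  have i1 := hI.mul_const K
  have i2 := hI.const_mul K
  refine ⟨i1.sub i2, ?_⟩
  rw [integral_sub i1 i2, integral_mul_const_of_integrable hI, integral_const_mul_of_integrable hI,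
    hE, smul_mul_assoc, mul_smul_comm, smul_sub]

theorem squared_localization_identity_bounded
    {𝓗 : Type*} [NormedAddCommGroup 𝓗] [InnerProductSpace ℂ 𝓗] [CompleteSpace 𝓗]
    (B D : 𝓗 →L[ℂ] 𝓗) (hB : IsSelfAdjoint B) (hD : IsSelfAdjoint D)
    (f : ℝ → ℝ) (hf : ContDiff ℝ (⊤ : ℕ∞) f) (hfsupp : HasCompactSupport f)
    (ftil : ℂ → ℂ) (hft : ContDiff ℝ (⊤ : ℕ∞) ftil) (hftsupp : HasCompactSupport ftil)
    (hext : ∀ x : ℝ, ftil (x : ℂ) = (f x : ℂ))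
    (haa : ∀ k : ℕ, ∃ C : ℝ, ∀ z : ℂ, ‖dbar ftil z‖ ≤ C * |z.im| ^ k) :
    (1 / 2 : ℂ) • (cfc (fun z : ℂ => (f z.re : ℂ)) B ^ 2 * D +
        D * cfc (fun z : ℂ => (f z.re : ℂ)) B ^ 2) =
      cfc (fun z : ℂ => (f z.re : ℂ)) B * D * cfc (fun z : ℂ => (f z.re : ℂ)) B +
        (2 * Real.pi ^ 2)⁻¹ • ∫ z₂ : ℂ, ∫ z₁ : ℂ,
          ((dbar ftil z₂) * (dbar ftil z₁)) •
            (Ring.inverse (B - z₂ • 1) * Ring.inverse (B - z₁ • 1) *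
              ((D * B - B * D) * B - B * (D * B - B * D)) *
              Ring.inverse (B - z₁ • 1) * Ring.inverse (B - z₂ • 1)) := by
  obtain ⟨hI, hE⟩ := commutator_integral B hB f ftil hft hftsupp hext haa (D * B - B * D)
  set T := cfc (fun z : ℂ => (f z.re : ℂ)) B with hT
  obtain ⟨-, hE2⟩ := commutator_integral B hB f ftil hft hftsupp hext haa (T * D - D * T)
  rw [← hT] at hE2
  have hcomm : T * B = B * T := by
    have := (cfc_commute_cfc (fun z : ℂ => (f z.re : ℂ)) (fun z : ℂ => z) B).eq
    rwa [cfc_id' ℂ B hB.isStarNormal] at this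
  have hinner : ∀ z₂ : ℂ, ∫ z₁ : ℂ, ((dbar ftil z₂) * (dbar ftil z₁)) •
            (Ring.inverse (B - z₂ • 1) * Ring.inverse (B - z₁ • 1) *
              ((D * B - B * D) * B - B * (D * B - B * D)) *
              Ring.inverse (B - z₁ • 1) * Ring.inverse (B - z₂ • 1)) =
      (Real.pi : ℂ) • (dbar ftil z₂ • (Ring.inverse (B - z₂ • (1 : 𝓗 →L[ℂ] 𝓗)) *
      ((T * D - D * T) * B - B * (T * D - D * T)) *
        Ring.inverse (B - z₂ • (1 : 𝓗 →L[ℂ] 𝓗)))) := by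
    intro z₂
    set R := Ring.inverse (B - z₂ • (1 : 𝓗 →L[ℂ] 𝓗)) with hR
    have h1 : ∀ z₁ : ℂ, ((dbar ftil z₂) * (dbar ftil z₁)) •
            (R * Ring.inverse (B - z₁ • 1) *
              ((D * B - B * D) * B - B * (D * B - B * D)) *
              Ring.inverse (B - z₁ • 1) * R) =
        dbar ftil z₂ • (R * (dbar ftil z₁ • (Ring.inverse (B - z₁ • (1 : 𝓗 →L[ℂ] 𝓗)) *
          ((D * B - B * D) * B - B * (D * B - B * D)) *
            Ring.inverse (B - z₁ • (1 : 𝓗 →L[ℂ] 𝓗)))) * R) := by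
      intro z₁
      simp only [mul_smul_comm, smul_mul_assoc, smul_smul, mul_assoc]
    have h2 : (T * D - D * T) * B - B * (T * D - D * T) =
        T * (D * B - B * D) - (D * B - B * D) * T := by
      have a1 : T * (B * D) = B * (T * D) := by rw [← mul_assoc, hcomm, mul_assoc]
      simp only [mul_sub, sub_mul, mul_assoc, a1, hcomm]
      abel
    simp only [h1]
    rw [integral_smul, integral_mul_const_of_integrable (hI.const_mul R),
      integral_const_mul_of_integrable hI, hE, h2, mul_smul_comm, smul_mul_assoc, smul_comm]
  simp only [hinner]
  rw [integral_smul, hE2, smul_smul, ← Complex.coe_smul, smul_smul]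
  have hpi : (Real.pi : ℂ) ≠ 0 := by exact_mod_cast Real.pi_ne_zero
  have hc : (((2 * Real.pi ^ 2)⁻¹ : ℝ) : ℂ) * ((Real.pi : ℂ) * Real.pi) = 1 / 2 := by
    push_cast
    field_simp
  rw [hc]
  have h3 : T ^ 2 * D + D * T ^ 2 =
      (2 : ℂ) • (T * D * T) + (T * (T * D - D * T) - (T * D - D * T) * T) := by
    rw [two_smul]
    simp only [pow_two, mul_sub, sub_mul, mul_assoc]
    abel
  rw [h3, smul_add, smul_smul]
  norm_num
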